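/- arXiv:1706.06211 — 2 statements merged into one kernel-verified Lean document; each statement's English description precedes it below -/
import Mathlib

section
/- Let C be a category and F : SingleObj (Multiplicative ℕ) ⥤ C a functor; write X for the value of F at the unique object and f : X ⟶ X for the image under F of the generator 1 ∈ ℕ. If the coequalizer of f and the identity of X exists in C, then the colimit of F exists and is isomorphic to the coequalizer of f and 𝟙 X. -/
open CategoryTheory CategoryTheory.Limits

namespace CategoryTheory.SingleObj

variable {C : Type*} [Category C] (F : SingleObj (Multiplicative ℕ) ⥤ C)

theorem map_comp_eq_of_map_ofAdd_one_comp_eq {Y : C}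
    (p : F.obj (SingleObj.star (Multiplicative ℕ)) ⟶ Y)
    (hp : F.map (X := SingleObj.star _) (Y := SingleObj.star _) (Multiplicative.ofAdd 1) ≫ p = p)
    (n : ℕ) :
    F.map (X := SingleObj.star _) (Y := SingleObj.star _) (Multiplicative.ofAdd n) ≫ p = p := by
  induction n with
  | zero =>
    have h : F.map (X := SingleObj.star _) (Y := SingleObj.star _)
        (Multiplicative.ofAdd (0 : ℕ)) = 𝟙 _ := F.map_id (SingleObj.star _)
    rw [h, Category.id_comp]
  | succ n ih =>
    have h : F.map (X := SingleObj.star _) (Y := SingleObj.star _)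
          (Multiplicative.ofAdd (n + 1)) =
        F.map (X := SingleObj.star _) (Y := SingleObj.star _) (Multiplicative.ofAdd 1) ≫
          F.map (X := SingleObj.star _) (Y := SingleObj.star _) (Multiplicative.ofAdd n) :=
      F.map_comp (X := SingleObj.star _) (Y := SingleObj.star _) (Z := SingleObj.star _)
        (Multiplicative.ofAdd 1) (Multiplicative.ofAdd n)
    rw [h, Category.assoc, ih, hp]

/-- The cocone on `F` given by a morphism that is invariant under the image of the generator. -/
def coconeOfMapOfAddOneCompEq {Y : C}
    (p : F.obj (SingleObj.star (Multiplicative ℕ)) ⟶ Y)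
    (hp : F.map (X := SingleObj.star _) (Y := SingleObj.star _) (Multiplicative.ofAdd 1) ≫ p = p) :
    Cocone F where
  pt := Y
  ι :=
    { app := fun _ => p
      naturality := fun _ _ n =>
        (map_comp_eq_of_map_ofAdd_one_comp_eq F p hp n).trans (Category.comp_id p).symm }

/-- A coequalizer of the image of the generator and the identity is a colimit of `F`. -/
def isColimitOfIsColimitCofork
    (s : Cofork (F.map (X := SingleObj.star _) (Y := SingleObj.star _) (Multiplicative.ofAdd 1))
      (𝟙 (F.obj (SingleObj.star (Multiplicative ℕ)))))
    (hs : IsColimit s) :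
    IsColimit (coconeOfMapOfAddOneCompEq F s.π (s.condition.trans (Category.id_comp _))) where
  desc t := Cofork.IsColimit.desc hs (t.ι.app (SingleObj.star _))
    ((t.w (j := SingleObj.star _) (j' := SingleObj.star _) (Multiplicative.ofAdd 1)).trans
      (Category.id_comp _).symm)
  fac t _ := Cofork.IsColimit.π_desc' hs (t.ι.app (SingleObj.star _)) _
  uniq _ _ hm := Cofork.IsColimit.hom_ext hs
    ((hm (SingleObj.star _)).trans (Cofork.IsColimit.π_desc' hs _ _).symm)

end CategoryTheory.SingleObj

/-- Let `F : SingleObj (Multiplicative ℕ) ⥤ C`, with value `X` at the unique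
object and `f : X ⟶ X` the image of the generator `1 ∈ ℕ`.  If the coequalizer of `f` and
`𝟙 X` exists in `C`, then the colimit of `F` exists and is isomorphic to this coequalizer. -/
theorem hasColimit_singleObj_functor_of_hasCoequalizer
    {C : Type*} [Category C] (F : SingleObj (Multiplicative ℕ) ⥤ C)
    (f : F.obj (SingleObj.star (Multiplicative ℕ)) ⟶ F.obj (SingleObj.star (Multiplicative ℕ)))
    (hf : f = F.map (Multiplicative.ofAdd 1))
    [HasCoequalizer f (𝟙 (F.obj (SingleObj.star (Multiplicative ℕ))))] :
    ∃ h : HasColimit F,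
      Nonempty (@colimit _ _ _ _ F h ≅
        coequalizer f (𝟙 (F.obj (SingleObj.star (Multiplicative ℕ))))) := by
  subst hf
  have hc := SingleObj.isColimitOfIsColimitCofork F _ (coequalizerIsCoequalizer _ _)
  have h : HasColimit F := ⟨⟨_, hc⟩⟩
  exact ⟨h, ⟨(colimit.isColimit F).coconePointUniqueUpToIso hc⟩⟩
end

section
/- Let R be a commutative ring and let M and N be modules over the polynomial ring R[X] (hence also R-modules by restriction). Then the tensor product M ⊗_{R[X]} N is isomorphic, as an R-module, to the quotient of M ⊗_R N by the R-submodule spanned by all elements of the form (X • m) ⊗ n − m ⊗ (X • n) for m ∈ M, n ∈ N. -/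
open scoped TensorProduct

/-- An `R`-linear map out of `M ⊗[R] N` that is balanced for the action of `X` is balanced for the
action of every polynomial. -/
lemma TensorProduct.map_polynomial_smul_tmul {R M N P : Type*} [CommRing R]
    [AddCommGroup M] [AddCommGroup N] [AddCommGroup P]
    [Module R M] [Module R N] [Module R P]
    [Module (Polynomial R) M] [Module (Polynomial R) N]
    [IsScalarTower R (Polynomial R) M] [IsScalarTower R (Polynomial R) N]
    (f : M ⊗[R] N →ₗ[R] P)
    (hf : ∀ m n, f (((Polynomial.X : Polynomial R) • m) ⊗ₜ[R] n) =
      f (m ⊗ₜ[R] ((Polynomial.X : Polynomial R) • n)))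
    (p : Polynomial R) (m : M) (n : N) :
    f ((p • m) ⊗ₜ[R] n) = f (m ⊗ₜ[R] (p • n)) := by
  induction p using Polynomial.induction_on generalizing m n with
  | C a =>
    simp only [← Polynomial.algebraMap_eq, algebraMap_smul, TensorProduct.smul_tmul]
  | add p q hp hq =>
    simp only [add_smul, TensorProduct.add_tmul, TensorProduct.tmul_add, map_add, hp, hq]
  | monomial k a ih =>
    rw [pow_succ, ← mul_assoc, mul_smul, ih, hf, ← mul_smul, mul_comm]

/-- The kernel of the canonical map `M ⊗[R] N → M ⊗[R[X]] N`. -/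
lemma TensorProduct.ker_mapOfCompatibleSMul_polynomial (R M N : Type*) [CommRing R]
    [AddCommGroup M] [AddCommGroup N] [Module R M] [Module R N]
    [Module (Polynomial R) M] [Module (Polynomial R) N]
    [IsScalarTower R (Polynomial R) M] [IsScalarTower R (Polynomial R) N] :
    (TensorProduct.mapOfCompatibleSMul (Polynomial R) R R M N).ker = Submodule.span R
      {z : M ⊗[R] N | ∃ m n,
        z = ((Polynomial.X : Polynomial R) • m) ⊗ₜ[R] n
            - m ⊗ₜ[R] ((Polynomial.X : Polynomial R) • n)} := by
  set S := Submodule.span R {z : M ⊗[R] N | ∃ m n,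
    z = ((Polynomial.X : Polynomial R) • m) ⊗ₜ[R] n
        - m ⊗ₜ[R] ((Polynomial.X : Polynomial R) • n)}
  refine le_antisymm (fun z hz ↦ ?_) (Submodule.span_le.2 ?_)
  · let b : M →+ N →+ (M ⊗[R] N) ⧸ S :=
      LinearMap.toAddMonoidHom'.comp
        ((TensorProduct.mk R M N).compr₂ S.mkQ).toAddMonoidHom
    have hb (p : Polynomial R) (m : M) (n : N) : b (p • m) n = b m (p • n) :=
      TensorProduct.map_polynomial_smul_tmul S.mkQ
        (fun m n ↦ (Submodule.Quotient.eq S).2 (Submodule.subset_span ⟨m, n, rfl⟩)) p m n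
    have h (z : M ⊗[R] N) : TensorProduct.liftAddHom b hb
        (TensorProduct.mapOfCompatibleSMul (Polynomial R) R R M N z) = S.mkQ z := by
      induction z with
      | zero => simp
      | add x y hx hy => simp only [map_add, hx, hy]
      | tmul m n => rfl
    rw [← Submodule.ker_mkQ S, LinearMap.mem_ker, ← h, LinearMap.mem_ker.1 hz, map_zero]
  · rintro - ⟨m, n, rfl⟩
    simp [TensorProduct.smul_tmul]

/-- For `R[X]`-modules `M`, `N` (with `R`-module structures by restriction of
scalars), the tensor product `M ⊗[R[X]] N` is isomorphic as an `R`-module to the quotient of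
`M ⊗[R] N` by the `R`-submodule spanned by the elements `(X • m) ⊗ n − m ⊗ (X • n)`. -/
theorem tensor_over_polynomial_iso_quotient (R : Type*) [CommRing R]
    (M N : Type*) [AddCommGroup M] [AddCommGroup N]
    [Module R M] [Module R N]
    [Module (Polynomial R) M] [Module (Polynomial R) N]
    [IsScalarTower R (Polynomial R) M] [IsScalarTower R (Polynomial R) N] :
    Nonempty ((M ⊗[Polynomial R] N) ≃ₗ[R]
      (M ⊗[R] N) ⧸ Submodule.span R
        {z : M ⊗[R] N | ∃ m n,
          z = ((Polynomial.X : Polynomial R) • m) ⊗ₜ[R] n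
              - m ⊗ₜ[R] ((Polynomial.X : Polynomial R) • n)}) := by
  rw [← TensorProduct.ker_mapOfCompatibleSMul_polynomial]
  exact ⟨(LinearMap.quotKerEquivOfSurjective _
    (TensorProduct.mapOfCompatibleSMul_surjective (Polynomial R) R R M N)).symm⟩
end
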